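/- Let B₀, B, B₁ be real Banach spaces, let j₀ : B₀ → B be an injective compact continuous linear map, and let j₁ : B → B₁ be an injective continuous linear map. Let a < b be real numbers, p > 1, and M ≥ 0. Let (fₙ)_{n∈ℕ} be a sequence of functions fₙ : ℝ → B₀ such that for every n: (i) ‖fₙ(t)‖_{B₀} ≤ M for every t ∈ [a, b]; (ii) the map t ↦ j₁(j₀(fₙ(t))) is differentiable on [a, b] with derivative gₙ satisfying ∫_a^b ‖gₙ(t)‖_{B₁}^p dt ≤ M. Then there exist a strictly increasing sequence n₁ < n₂ < ⋯ and a continuous function g : ℝ → B such that sup_{t∈[a,b]} ‖j₀(f_{n_k}(t)) − g(t)‖_B → 0 as k → ∞. -/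

import Mathlib

open MeasureTheory

open Set Filter Topology

theorem Continuous.isUniformInducing_of_injective {X Y : Type*} [UniformSpace X] [CompactSpace X]
    [UniformSpace Y] [T2Space Y] {f : X → Y} (hf : Continuous f) (hinj : Function.Injective f) :
    IsUniformInducing f := by
  rw [isUniformInducing_iff_uniformSpace]
  exact unique_uniformity_of_compact (hf.isClosedEmbedding hinj).isInducing.eq_induced.symm rfl

/-- Hölder continuity of a function on `[a, b]` whose derivative lies in `L^p`. -/
theorem enorm_sub_le_of_lintegral_rpow_deriv_le {E : Type*} [NormedAddCommGroup E]
    [NormedSpace ℝ E] [CompleteSpace E] {a b p : ℝ} (hp : 1 < p) {C : ENNReal} (hC : C ≠ ⊤)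
    {v v' : ℝ → E} (hv : ∀ x ∈ Icc a b, HasDerivWithinAt v (v' x) (Icc a b) x)
    (hint : ∫⁻ x in Ioc a b, ‖v' x‖ₑ ^ p ≤ C) {s t : ℝ} (hs : a ≤ s) (hst : s ≤ t) (ht : t ≤ b) :
    ‖v t - v s‖ₑ ≤ C ^ (1 / p) * ENNReal.ofReal (t - s) ^ (1 - 1 / p) := by
  have hp0 : 0 < p := by linarith
  have hq : 0 ≤ 1 - 1 / p := sub_nonneg.2 ((div_le_one hp0).2 hp.le)
  have hat : ∀ x ∈ Ioo s t, HasDerivAt v (v' x) x := fun x hx =>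
    (hv x ⟨hs.trans hx.1.le, hx.2.le.trans ht⟩).hasDerivAt
      (Icc_mem_nhds (hs.trans_lt hx.1) (hx.2.trans_le ht))
  have hmeas : AEStronglyMeasurable v' (volume.restrict (Ioc s t)) := by
    rw [← restrict_Ioo_eq_restrict_Ioc]
    refine (aestronglyMeasurable_deriv v _).congr ?_
    filter_upwards [ae_restrict_mem measurableSet_Ioo] with x hx using (hat x hx).deriv
  have hbound : ∫⁻ x in Ioc s t, ‖v' x‖ₑ ≤
      C ^ (1 / p) * ENNReal.ofReal (t - s) ^ (1 - 1 / p) := by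
    have h := eLpNorm'_le_eLpNorm'_mul_rpow_measure_univ one_pos hp.le hmeas
    simp only [eLpNorm', ENNReal.rpow_one, div_one, Measure.restrict_apply_univ,
      Real.volume_Ioc] at h
    refine h.trans ?_
    gcongr
    exact (lintegral_mono_set (Ioc_subset_Ioc hs ht)).trans hint
  have hii : IntervalIntegrable v' volume s t := by
    rw [intervalIntegrable_iff_integrableOn_Ioc_of_le hst]
    refine ⟨hmeas, hbound.trans_lt (ENNReal.mul_lt_top ?_ ?_)⟩
    · exact ENNReal.rpow_lt_top_of_nonneg (by positivity) hC
    · exact ENNReal.rpow_lt_top_of_nonneg hq ENNReal.ofReal_ne_top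
  have hcont : ContinuousOn v (Icc s t) := fun x hx =>
    (hv x (Icc_subset_Icc hs ht hx)).continuousWithinAt.mono (Icc_subset_Icc hs ht)
  rw [← intervalIntegral.integral_eq_sub_of_hasDerivAt_of_le hst hcont hat hii,
    intervalIntegral.integral_of_le hst]
  exact (enorm_integral_le_lintegral_enorm _).trans hbound

/-- A family of functions on `[a, b]` with derivatives bounded in `L^p`, `p > 1`, is uniformly
equicontinuous. -/
theorem uniformEquicontinuous_of_lintegral_rpow_deriv_le {ι E : Type*} [NormedAddCommGroup E]
    [NormedSpace ℝ E] [CompleteSpace E] {a b p : ℝ} (hp : 1 < p) {C : ENNReal} (hC : C ≠ ⊤)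
    {v v' : ι → ℝ → E}
    (hv : ∀ i, ∀ x ∈ Icc a b, HasDerivWithinAt (v i) (v' i x) (Icc a b) x)
    (hint : ∀ i, ∫⁻ x in Ioc a b, ‖v' i x‖ₑ ^ p ≤ C) :
    UniformEquicontinuous fun i (x : Icc a b) => v i x := by
  have hp0 : 0 < p := by linarith
  have hq : 0 < 1 - 1 / p := sub_pos.2 ((div_lt_one hp0).2 hp)
  have hK : C ^ (1 / p) ≠ ⊤ := ENNReal.rpow_ne_top_of_nonneg (by positivity) hC
  let ω : ℝ → ENNReal := fun d => C ^ (1 / p) * ENNReal.ofReal d ^ (1 - 1 / p)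
  have hω : Tendsto (fun d => (ω d).toReal) (𝓝 0) (𝓝 0) := by
    have hc : Continuous ω := (ENNReal.continuous_const_mul hK).comp
      (ENNReal.continuous_rpow_const.comp ENNReal.continuous_ofReal)
    have h0 : ω 0 = 0 := by
      simp only [ω, ENNReal.ofReal_zero, ENNReal.zero_rpow_of_pos hq, mul_zero]
    have := (ENNReal.tendsto_toReal (a := ω 0) (by simp [h0])).comp (hc.tendsto 0)
    simpa only [Function.comp_def, h0, ENNReal.toReal_zero] using this
  have hfin : ∀ d, ω d ≠ ⊤ := fun d => ENNReal.mul_ne_top hK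
    (ENNReal.rpow_ne_top_of_nonneg hq.le ENNReal.ofReal_ne_top)
  refine Metric.uniformEquicontinuous_of_continuity_modulus _ hω _ fun x y i => ?_
  wlog hxy : x ≤ y generalizing x y
  · rw [dist_comm, dist_comm x y]
    exact this y x (le_of_not_ge hxy)
  have h := enorm_sub_le_of_lintegral_rpow_deriv_le hp hC (hv i) (hint i) x.2.1 hxy y.2.2
  rw [dist_comm, dist_comm x y, dist_eq_norm, Subtype.dist_eq, Real.dist_eq,
    abs_of_nonneg (sub_nonneg.2 (Subtype.coe_le_coe.2 hxy)), ← toReal_enorm]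
  exact ENNReal.toReal_mono (hfin _) h

/-- Sequential form of the Arzelà–Ascoli theorem for maps between compact spaces. -/
theorem Equicontinuous.exists_subseq_tendstoUniformly {X Y : Type*} [TopologicalSpace X]
    [CompactSpace X] [MetricSpace Y] [CompactSpace Y] {F : ℕ → X → Y} (hF : Equicontinuous F) :
    ∃ φ : ℕ → ℕ, StrictMono φ ∧ ∃ G : X → Y, Continuous G ∧
      TendstoUniformly (fun k => F (φ k)) G atTop := by
  let Φ : ℕ → BoundedContinuousFunction X Y := fun n =>
    BoundedContinuousFunction.mkOfCompact ⟨F n, hF.continuous n⟩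
  have hΦ : Equicontinuous ((↑) : range Φ → X → Y) := by
    intro x U hU
    filter_upwards [hF x U hU] with y hy
    rintro ⟨_, n, rfl⟩
    exact hy n
  have hcpt := BoundedContinuousFunction.arzela_ascoli univ isCompact_univ (range Φ)
    (fun _ _ _ => mem_univ _) hΦ
  obtain ⟨G, -, φ, hφ, hlim⟩ := hcpt.tendsto_subseq
    (fun n => subset_closure (mem_range_self (f := Φ) n))
  exact ⟨φ, hφ, G, G.continuous, BoundedContinuousFunction.tendsto_iff_tendstoUniformly.1 hlim⟩

/-- Aubin–Lions–Simon compactness lemma (Lemma 2.7 of the paper): for Banach spaces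
`B₀ ⊂ B ⊂ B₁` modeled by an injective compact continuous linear map `j₀ : B₀ → B` and an
injective continuous linear map `j₁ : B → B₁`, a sequence `(fₙ)` bounded by `M` in
`B₀`-norm on `[a,b]` whose compositions `t ↦ j₁(j₀(fₙ(t)))` are differentiable on `[a,b]`
with derivatives `gₙ` satisfying `∫_a^b ‖gₙ‖_{B₁}^p ≤ M`, `p > 1`, has a subsequence such
that `j₀ ∘ f_{n_k}` converges uniformly on `[a,b]` to a continuous function `g : ℝ → B`. -/
theorem aubin_lions_simon
    {B₀ B B₁ : Type*}
    [NormedAddCommGroup B₀] [NormedSpace ℝ B₀] [CompleteSpace B₀]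
    [NormedAddCommGroup B] [NormedSpace ℝ B] [CompleteSpace B]
    [NormedAddCommGroup B₁] [NormedSpace ℝ B₁] [CompleteSpace B₁]
    (j₀ : B₀ →L[ℝ] B) (hinj₀ : Function.Injective j₀) (hcomp₀ : IsCompactOperator j₀)
    (j₁ : B →L[ℝ] B₁) (hinj₁ : Function.Injective j₁)
    (a b : ℝ) (hab : a < b) (p : ℝ) (hp : 1 < p) (M : ℝ) (hM : 0 ≤ M)
    (f : ℕ → ℝ → B₀) (g : ℕ → ℝ → B₁)
    (hbdd : ∀ n, ∀ t ∈ Set.Icc a b, ‖f n t‖ ≤ M)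
    (hderiv : ∀ n, ∀ t ∈ Set.Icc a b,
      HasDerivWithinAt (fun s => j₁ (j₀ (f n s))) (g n t) (Set.Icc a b) t)
    (hint : ∀ n, ∫⁻ t in Set.Ioc a b, (‖g n t‖₊ : ENNReal) ^ p ≤ ENNReal.ofReal M) :
    ∃ φ : ℕ → ℕ, StrictMono φ ∧ ∃ glim : ℝ → B, Continuous glim ∧
      TendstoUniformlyOn (fun k t => j₀ (f (φ k) t)) glim Filter.atTop (Set.Icc a b) := by
  let K : Set B := closure (j₀ '' Metric.closedBall 0 M)
  have hK : IsCompact K := hcomp₀.isCompact_closure_image_closedBall M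
  have : CompactSpace K := isCompact_iff_compactSpace.1 hK
  let u : ℕ → Icc a b → K := fun n t =>
    ⟨j₀ (f n t), subset_closure ⟨f n t, by simpa using hbdd n t t.2, rfl⟩⟩
  have hj : IsUniformInducing fun x : K => j₁ x :=
    (j₁.continuous.comp continuous_subtype_val).isUniformInducing_of_injective
      (hinj₁.comp Subtype.val_injective)
  have hu : UniformEquicontinuous u := hj.uniformEquicontinuous_iff.2
    (uniformEquicontinuous_of_lintegral_rpow_deriv_le hp ENNReal.ofReal_ne_top hderiv hint)
  obtain ⟨φ, hφ, G, hG, hlim⟩ := hu.equicontinuous.exists_subseq_tendstoUniformly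
  refine ⟨φ, hφ, IccExtend hab.le fun t => (G t : B),
    (continuous_subtype_val.comp hG).Icc_extend', ?_⟩
  rw [tendstoUniformlyOn_iff_tendstoUniformly_comp_coe]
  convert uniformContinuous_subtype_val.comp_tendstoUniformly hlim using 1
  · rfl
  · ext t
    simp
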